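/- For complex q, z with 0 < |q| < 1 and |z| < 1, the sequence of convergents Conv_h(q,z) = P_h(q,z)/Q_h(q,z) of the square series J-fraction converges as h → ∞, and its limit equals the ordinary geometric square series ∑_{n=0}^{∞} q^{n²} z^n. -/

import Mathlib

/-- The numerator convergents `P_h(q, z)` of the square series J-fraction. -/
noncomputable def Pconv (q z : ℂ) : ℕ → ℂ
  | 0 => 0
  | 1 => 1
  | (h + 2) =>
      (1 - q ^ (2 * (h + 2) - 3) * (q ^ (2 * (h + 2)) + q ^ (2 * (h + 2) - 2) - 1) * z) *
          Pconv q z (h + 1)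
        - q ^ (6 * (h + 2) - 10) * (q ^ (2 * (h + 2) - 2) - 1) * z ^ 2 * Pconv q z h

/-- The denominator convergents `Q_h(q, z)` of the square series J-fraction. -/
noncomputable def Qconv (q z : ℂ) : ℕ → ℂ
  | 0 => 1
  | 1 => 1 - q * z
  | (h + 2) =>
      (1 - q ^ (2 * (h + 2) - 3) * (q ^ (2 * (h + 2)) + q ^ (2 * (h + 2) - 2) - 1) * z) *
          Qconv q z (h + 1)
        - q ^ (6 * (h + 2) - 10) * (q ^ (2 * (h + 2) - 2) - 1) * z ^ 2 * Qconv q z h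

/-- Rogers-Szego type polynomials. -/
noncomputable def RS (p : ℂ) : ℕ → ℂ → ℂ
  | 0, _ => 1
  | (h + 1), t => RS p h (p * t) - t * RS p h t

lemma RS_diff (p : ℂ) (h : ℕ) : ∀ t, RS p (h + 1) t - RS p (h + 1) (p * t) =
    -(1 - p ^ (h + 1)) * t * RS p h t := by
  induction h with
  | zero => intro t; simp only [RS]; ring
  | succ h ih =>
    intro t
    have h1 := ih t
    have h2 := ih (p * t)
    have e1 : RS p (h + 2) t = RS p (h + 1) (p * t) - t * RS p (h + 1) t := rfl
    have e2 : RS p (h + 2) (p * t) =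
      RS p (h + 1) (p * (p * t)) - (p * t) * RS p (h + 1) (p * t) := rfl
    have e3 : RS p (h + 1) t = RS p h (p * t) - t * RS p h t := rfl
    rw [show h + 1 + 1 = h + 2 from rfl, e1, e2]
    linear_combination h2 - p * t * h1 + (1 - p ^ (h + 1)) * p * t * e3

lemma RS_pascal (p : ℂ) (h : ℕ) (t : ℂ) : RS p (h + 1) (p * t) =
    RS p h (p * t) - p ^ (h + 1) * t * RS p h t := by
  have h1 := RS_diff p h t
  have e3 : RS p (h + 1) t = RS p h (p * t) - t * RS p h t := rfl
  linear_combination e3 - h1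

lemma RS_rec (p s : ℂ) (h : ℕ) : RS p (h + 2) (p * (p * s)) =
    (1 - p * s * (p ^ (h + 2) + p ^ (h + 1) - 1)) * RS p (h + 1) (p * s)
      - s ^ 2 * p ^ (h + 2) * (p ^ (h + 1) - 1) * RS p h s := by
  have h1 := RS_pascal p (h + 1) (p * s)
  have h2 := RS_diff p h (p * s)
  have h3 := RS_pascal p h s
  rw [show h + 1 + 1 = h + 2 from rfl] at h1
  linear_combination h1 - h2 - (1 - p ^ (h + 1)) * p * s * h3

lemma RS_bound (p : ℂ) (hp : ‖p‖ ≤ 1) (r : ℝ) (h : ℕ) : ∀ t, ‖t‖ ≤ r →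
    ‖RS p h t - 1‖ ≤ (1 + r) ^ h - 1 := by
  induction h with
  | zero => intro t _; simp [RS]
  | succ h ih =>
    intro t ht
    have hr : 0 ≤ r := (norm_nonneg t).trans ht
    have hpt : ‖p * t‖ ≤ r := by
      rw [norm_mul]; nlinarith [norm_nonneg t, norm_nonneg p]
    have h1 := ih t ht
    have h2 := ih _ hpt
    have h3 : ‖RS p h t‖ ≤ (1 + r) ^ h := by
      have := norm_add_le (RS p h t - 1) 1
      simp only [sub_add_cancel, norm_one] at this
      linarith
    have e3 : RS p (h + 1) t - 1 = (RS p h (p * t) - 1) - t * RS p h t := by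
      simp only [RS]; ring
    rw [e3]
    have h4 : ‖t * RS p h t‖ ≤ r * (1 + r) ^ h := by
      rw [norm_mul]; exact mul_le_mul ht h3 (norm_nonneg _) hr
    calc _ ≤ _ := norm_sub_le _ _
      _ ≤ ((1 + r) ^ h - 1) + r * (1 + r) ^ h := add_le_add h2 h4
      _ = _ := by ring

lemma Qconv_eq (q z : ℂ) (hq : q ≠ 0) : ∀ h, Qconv q z h = RS (q ^ 2) h ((q ^ 2) ^ h * (z / q))
  | 0 => by simp [Qconv, RS]
  | 1 => by simp only [Qconv, RS]; field_simp
  | (h + 2) => by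
    have r := RS_rec (q ^ 2) ((q ^ 2) ^ h * (z / q)) h
    have e1 : q ^ 2 * ((q ^ 2) ^ h * (z / q)) = (q ^ 2) ^ (h + 1) * (z / q) := by ring
    have e2 : q ^ 2 * ((q ^ 2) ^ (h + 1) * (z / q)) = (q ^ 2) ^ (h + 2) * (z / q) := by ring
    rw [e1, e2] at r
    rw [r, Qconv, Qconv_eq q z hq (h + 1), Qconv_eq q z hq h,
      show 2 * (h + 2) - 3 = 2 * h + 1 by omega, show 2 * (h + 2) - 2 = 2 * h + 2 by omega,
      show 6 * (h + 2) - 10 = 6 * h + 2 by omega]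
    have a1 : q ^ (2 * h + 1) * z = (q ^ 2) ^ (h + 1) * (z / q) := by
      field_simp; ring
    have a2 : q ^ (6 * h + 2) * z ^ 2 = ((q ^ 2) ^ h * (z / q)) ^ 2 * (q ^ 2) ^ (h + 2) := by
      field_simp; ring
    rw [← a1]
    linear_combination (-(q ^ (2 * h + 2) - 1) *
      RS (q ^ 2) h ((q ^ 2) ^ h * (z / q))) * a2

/-- Summands of the remainder. -/
noncomputable def TT (q z : ℂ) (h m : ℕ) : ℂ :=
  q ^ (m ^ 2) * z ^ m * ∏ i ∈ Finset.range h, (q ^ (2 * m) - q ^ (2 * i))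

lemma TT_norm (q z : ℂ) (hq1 : ‖q‖ < 1) (h m : ℕ) : ‖TT q z h m‖ ≤ 2 ^ h * ‖z‖ ^ m := by
  have h1 : ‖∏ i ∈ Finset.range h, (q ^ (2 * m) - q ^ (2 * i))‖ ≤ 2 ^ h := by
    rw [norm_prod]
    calc _ ≤ ∏ i ∈ Finset.range h, (2 : ℝ) := by
          apply Finset.prod_le_prod
          · intros; positivity
          · intro i _
            refine (norm_sub_le _ _).trans ?_
            rw [norm_pow, norm_pow]
            have := pow_le_one₀ (n := 2 * m) (norm_nonneg q) hq1.le
            have := pow_le_one₀ (n := 2 * i) (norm_nonneg q) hq1.le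
            linarith
      _ = _ := by simp
  have h2 : ‖q ^ (m ^ 2)‖ ≤ 1 := by
    rw [norm_pow]; exact pow_le_one₀ (norm_nonneg q) hq1.le
  unfold TT
  rw [norm_mul, norm_mul, norm_pow z, mul_comm]
  apply mul_le_mul h1 _ (by positivity) (by positivity)
  exact mul_le_of_le_one_left (by positivity) h2

lemma TT_summable (q z : ℂ) (hq1 : ‖q‖ < 1) (hz : ‖z‖ < 1) (h : ℕ) :
    Summable (TT q z h) :=
  Summable.of_norm_bounded
    ((summable_geometric_of_lt_one (norm_nonneg z) hz).mul_left (2 ^ h)) (TT_norm q z hq1 h)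

lemma TT_shift (q z : ℂ) (h m : ℕ) : TT q z (h + 1) (m + 1) =
    q ^ (2 * m + 1) * z * (q ^ (2 * m + 2) - 1) * q ^ (2 * h) * TT q z h m := by
  unfold TT
  rw [Finset.prod_range_succ']
  have : ∏ i ∈ Finset.range h, (q ^ (2 * (m + 1)) - q ^ (2 * (i + 1))) =
      q ^ (2 * h) * ∏ i ∈ Finset.range h, (q ^ (2 * m) - q ^ (2 * i)) := by
    rw [pow_mul q 2 h, ← Finset.card_range h, ← Finset.prod_const, Finset.card_range,
      ← Finset.prod_mul_distrib]
    apply Finset.prod_congr rfl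
    intros; ring
  rw [this]
  ring

lemma TT_succ (q z : ℂ) (h m : ℕ) : TT q z (h + 1) m =
    TT q z h m * (q ^ (2 * m) - q ^ (2 * h)) := by
  unfold TT
  rw [Finset.prod_range_succ]
  ring

lemma TT_tsum (q z : ℂ) (hq1 : ‖q‖ < 1) (hz : ‖z‖ < 1) (h : ℕ) :
    ∑' m, TT q z (h + 1) m = ∑' m, TT q z (h + 1) (m + 1) := by
  rw [(TT_summable q z hq1 hz (h + 1)).tsum_eq_zero_add]
  have : TT q z (h + 1) 0 = 0 := by
    unfold TT
    rw [Finset.prod_range_succ']; simp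
  rw [this, zero_add]

lemma rem_eq (q z : ℂ) (hq1 : ‖q‖ < 1) (hz : ‖z‖ < 1) : ∀ h,
    (∑' n : ℕ, q ^ (n ^ 2) * z ^ n) * Qconv q z h - Pconv q z h =
      z ^ h * q ^ (h ^ 2) * ∑' m, TT q z h m
  | 0 => by simp [Qconv, Pconv, TT]
  | 1 => by
    have e0 : ∀ n : ℕ, q ^ (n ^ 2) * z ^ n = TT q z 0 n := by intro n; simp [TT]
    simp only [e0]
    have hs := TT_summable q z hq1 hz 0
    have hs1 := TT_summable q z hq1 hz 1
    have hs' : Summable fun m => TT q z 0 (m + 1) := (summable_nat_add_iff 1).2 hs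
    have k : ∑' m, (z * q * TT q z 1 m + z * q * TT q z 0 m) = ∑' m, TT q z 0 (m + 1) := by
      congr 1; ext m; rw [TT_succ q z 0]; simp [TT]; ring
    rw [(hs1.mul_left _).tsum_add (hs.mul_left _), tsum_mul_left, tsum_mul_left] at k
    have k2 := hs.tsum_eq_zero_add
    have k3 : TT q z 0 0 = 1 := by simp [TT]
    rw [k3] at k2
    simp only [Qconv, Pconv]
    linear_combination k2 - k
  | (h + 2) => by
    have i1 := rem_eq q z hq1 hz (h + 1)
    have i0 := rem_eq q z hq1 hz h
    have hs := TT_summable q z hq1 hz h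
    have hs1 := TT_summable q z hq1 hz (h + 1)
    have hs2 := TT_summable q z hq1 hz (h + 2)
    have hs1' : Summable fun m => TT q z (h + 1) (m + 1) := (summable_nat_add_iff 1).2 hs1
    have k : ∑' m, z * q ^ (4 * h + 4) * TT q z (h + 2) m =
        ∑' m, (q ^ (2 * h + 1) * TT q z (h + 1) (m + 1) -
          q ^ (2 * h + 1) * (q ^ (2 * h + 1) * (q ^ (2 * h + 4) + q ^ (2 * h + 2) - 1) * z) *
            TT q z (h + 1) m -
          q ^ (6 * h + 2) * (q ^ (2 * h + 2) - 1) * z * TT q z h m) := by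
      congr 1; ext m; rw [TT_shift, TT_succ q z (h + 1), TT_succ q z h]; ring
    rw [((hs1'.mul_left _).sub (hs1.mul_left _)).tsum_sub (hs.mul_left _),
      (hs1'.mul_left _).tsum_sub (hs1.mul_left _),
      tsum_mul_left, tsum_mul_left, tsum_mul_left, tsum_mul_left, ← TT_tsum q z hq1 hz] at k
    rw [Qconv, Pconv,
      show 2 * (h + 2) - 3 = 2 * h + 1 by omega, show 2 * (h + 2) - 2 = 2 * h + 2 by omega,
      show 6 * (h + 2) - 10 = 6 * h + 2 by omega]
    linear_combination (1 - q ^ (2 * h + 1) * (q ^ (2 * (h + 2)) + q ^ (2 * h + 2) - 1) * z) * i1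
      - q ^ (6 * h + 2) * (q ^ (2 * h + 2) - 1) * z ^ 2 * i0
      - z ^ (h + 1) * q ^ (h ^ 2) * k

lemma Q_tendsto (q z : ℂ) (hq0 : 0 < ‖q‖) (hq1 : ‖q‖ < 1) :
    Filter.Tendsto (Qconv q z) Filter.atTop (nhds 1) := by
  have hq : q ≠ 0 := norm_pos_iff.1 hq0
  rw [tendsto_iff_norm_sub_tendsto_zero]
  have hp : ‖q‖ ^ 2 < 1 := pow_lt_one₀ hq0.le hq1 two_ne_zero
  have l1 : Filter.Tendsto (fun h : ℕ => Real.exp ((h * (‖q‖ ^ 2) ^ h) * ‖z / q‖) - 1)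
      Filter.atTop (nhds 0) := by
    have := tendsto_self_mul_const_pow_of_lt_one (sq_nonneg ‖q‖) hp
    have := ((Real.continuous_exp.tendsto _).comp (this.mul_const ‖z / q‖)).sub_const 1
    simpa using this
  refine squeeze_zero (fun _ => norm_nonneg _) (fun h => ?_) l1
  rw [Qconv_eq q z hq]
  have := RS_bound (q ^ 2) (by rw [norm_pow]; exact hp.le) ((‖q‖ ^ 2) ^ h * ‖z / q‖) h
    ((q ^ 2) ^ h * (z / q)) (by rw [norm_mul, norm_pow, norm_pow])
  refine this.trans (sub_le_sub_right ?_ 1)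
  rw [mul_assoc, Real.exp_nat_mul]
  apply pow_le_pow_left₀ (by positivity)
  rw [add_comm]
  exact Real.add_one_le_exp _

lemma rem_tendsto (q z : ℂ) (hq0 : 0 < ‖q‖) (hq1 : ‖q‖ < 1) (hz : ‖z‖ < 1) :
    Filter.Tendsto (fun h : ℕ => z ^ h * q ^ (h ^ 2) * ∑' m, TT q z h m)
      Filter.atTop (nhds 0) := by
  have hg := summable_geometric_of_lt_one (norm_nonneg z) hz
  have hb : ∀ h, ‖∑' m, TT q z h m‖ ≤ 2 ^ h * ∑' m, ‖z‖ ^ m := by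
    intro h
    rw [← tsum_mul_left]
    exact tsum_of_norm_bounded (hg.mul_left _).hasSum (TT_norm q z hq1 h)
  set C := ∑' m, ‖z‖ ^ m with hC
  have hC0 : 0 ≤ C := tsum_nonneg (fun _ => by positivity)
  have l0 : Filter.Tendsto (fun h : ℕ => 2 * ‖q‖ ^ h) Filter.atTop (nhds 0) := by
    simpa using (tendsto_pow_atTop_nhds_zero_of_lt_one hq0.le hq1).const_mul 2
  have l1 : Filter.Tendsto (fun h : ℕ => (1 / 2 : ℝ) ^ h * C) Filter.atTop (nhds 0) := by
    simpa using (tendsto_pow_atTop_nhds_zero_of_lt_one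
      (by norm_num : (0 : ℝ) ≤ 1 / 2) (by norm_num)).mul_const C
  refine squeeze_zero_norm' ?_ l1
  filter_upwards [l0.eventually_le_const (by norm_num : (0 : ℝ) < 1 / 2)] with h hh
  have h1 : ‖z‖ ^ h ≤ 1 := pow_le_one₀ (norm_nonneg _) hz.le
  calc ‖z ^ h * q ^ (h ^ 2) * ∑' m, TT q z h m‖
      = ‖z‖ ^ h * ‖q‖ ^ (h ^ 2) * ‖∑' m, TT q z h m‖ := by
        rw [norm_mul, norm_mul, norm_pow, norm_pow]
    _ ≤ 1 * ‖q‖ ^ (h ^ 2) * (2 ^ h * C) := by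
        gcongr
        exact hb h
    _ = (2 * ‖q‖ ^ h) ^ h * C := by
        rw [mul_pow, ← pow_mul, sq]; ring
    _ ≤ _ := by gcongr

theorem stmt12 (q z : ℂ) (hq0 : 0 < ‖q‖) (hq1 : ‖q‖ < 1) (hz : ‖z‖ < 1) :
    Filter.Tendsto (fun h : ℕ => Pconv q z h / Qconv q z h) Filter.atTop
      (nhds (∑' n : ℕ, q ^ (n ^ 2) * z ^ n)) := by
  have hQ := Q_tendsto q z hq0 hq1
  have hR := rem_tendsto q z hq0 hq1 hz
  have l := ((hR.div hQ one_ne_zero).const_sub (∑' n : ℕ, q ^ (n ^ 2) * z ^ n))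
  rw [zero_div, sub_zero] at l
  refine l.congr' ?_
  filter_upwards [hQ.eventually_ne one_ne_zero] with h hh
  have := rem_eq q z hq1 hz h
  rw [Pi.div_apply, ← this]
  field_simp
  ring
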